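/- In a commutative A-loop, the product of two squares is a square: for all x, y there exists z with x^2 y^2 = z^2; explicitly, x^2 y^2 = (x∘y)^2 where x∘y = ((xy\x)·(yx\y))^{-1}. -/

import Mathlib

/-- A commutative loop: commutative binary operation with two-sided identity
and a left division making all translations bijective. -/
class CommLoop (Q : Type*) extends Mul Q, One Q where
  mul_comm : ∀ x y : Q, x * y = y * x
  one_mul : ∀ x : Q, 1 * x = x
  mul_one : ∀ x : Q, x * 1 = x
  ldiv : Q → Q → Q
  mul_ldiv : ∀ x y : Q, x * ldiv x y = y
  ldiv_mul : ∀ x y : Q, ldiv x (x * y) = y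

namespace CommLoop

variable {Q : Type*} [CommLoop Q]

/-- The inverse `x⁻¹ = x \ 1`. -/
def inv (x : Q) : Q := ldiv x 1

/-- The inner mapping `L_{x,y} = L_x L_y L_{yx}⁻¹` (permutations acting on the right):
`z L_{x,y} = (yx) \ (y(xz))`. -/
def inn (x y z : Q) : Q := ldiv (y * x) (y * (x * z))

/-- Natural powers: `x^n = 1 L_x^n`. -/
def npow (x : Q) (n : ℕ) : Q := (fun y => x * y)^[n] 1

/-- Integer powers: `x^n = 1 L_x^n`. -/
def zpow (x : Q) : ℤ → Q
  | Int.ofNat n => npow x n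
  | Int.negSucc n => (fun y => ldiv x y)^[n + 1] 1

/-- A commutative A-loop: every inner mapping `L_{x,y}` is an automorphism. -/
class IsALoop (Q : Type*) [CommLoop Q] : Prop where
  inn_mul : ∀ x y u v : Q, inn x y (u * v) = inn x y u * inn x y v

/-- The left translation `L_x` as a permutation of `Q`. -/
def Le (x : Q) : Equiv.Perm Q :=
  ⟨fun y => x * y, fun y => ldiv x y, fun y => ldiv_mul x y, fun y => mul_ldiv x y⟩

/-- The permutation `P_x = L_x L_{x⁻¹}⁻¹`. -/
def Pe (x : Q) : Equiv.Perm Q := (Le x).trans (Le (inv x)).symm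

end CommLoop

namespace CommLoop

variable {Q : Type*} [CommLoop Q]

theorem eq_of_mul_eq_mul_left {x y z : Q} (h : x * y = x * z) : y = z := by
  rw [← ldiv_mul x y, h, ldiv_mul]

theorem eq_ldiv_of_mul_eq {x y z : Q} (h : x * y = z) : ldiv x z = y := by
  rw [← h, ldiv_mul]

theorem mul_inv_self (x : Q) : x * inv x = 1 := mul_ldiv x 1

theorem inv_mul_self (x : Q) : inv x * x = 1 := by
  rw [CommLoop.mul_comm, mul_inv_self]

theorem inv_eq_of_mul_eq_one {x y : Q} (h : x * y = 1) : inv x = y :=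
  eq_ldiv_of_mul_eq h

theorem inv_inv_self (x : Q) : inv (inv x) = x :=
  inv_eq_of_mul_eq_one (inv_mul_self x)

theorem mul_mul_inn (x y z : Q) : (y * x) * inn x y z = y * (x * z) :=
  mul_ldiv _ _

theorem inn_eq_of_mul_eq {x y z t : Q} (h : (y * x) * t = y * (x * z)) : inn x y z = t :=
  eq_ldiv_of_mul_eq h

theorem inn_injective {x y u v : Q} (h : inn x y u = inn x y v) : u = v := by
  have h' : y * (x * u) = y * (x * v) := by rw [← mul_mul_inn, h, mul_mul_inn]
  exact eq_of_mul_eq_mul_left (eq_of_mul_eq_mul_left h')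

theorem inn_one (x y : Q) : inn x y 1 = 1 :=
  inn_eq_of_mul_eq (by rw [CommLoop.mul_one, CommLoop.mul_one])

theorem inn_right (x y : Q) : inn x y y = y :=
  inn_eq_of_mul_eq (by rw [CommLoop.mul_comm, CommLoop.mul_comm y x])

/-- The permutation `P_x`, written as a binary operation: `pop x y = x⁻¹ \ (x y)`. -/
def pop (x y : Q) : Q := ldiv (inv x) (x * y)

/-- The map `y ↦ x² \ (y P_x)`. -/
def sqPop (x y : Q) : Q := ldiv (x * x) (pop x y)

theorem inv_mul_pop (x y : Q) : inv x * pop x y = x * y := mul_ldiv _ _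

theorem pop_eq_of_mul_eq {x y z : Q} (h : inv x * z = x * y) : pop x y = z :=
  eq_ldiv_of_mul_eq h

theorem pop_ldiv (x y : Q) : pop x (ldiv x y) = ldiv (inv x) y := by
  rw [pop, mul_ldiv]

theorem sq_mul_sqPop (x y : Q) : (x * x) * sqPop x y = pop x y := mul_ldiv _ _

theorem sqPop_eq_of_mul_eq {x y z : Q} (h : (x * x) * z = pop x y) : sqPop x y = z :=
  eq_ldiv_of_mul_eq h

theorem sqPop_injective {x u v : Q} (h : sqPop x u = sqPop x v) : u = v := by
  have h' : pop x u = pop x v := by rw [← sq_mul_sqPop, h, sq_mul_sqPop]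
  have h'' : x * u = x * v := by rw [← inv_mul_pop, h', inv_mul_pop]
  exact eq_of_mul_eq_mul_left h''

variable [IsALoop Q]

theorem inn_mul (x y u v : Q) : inn x y (u * v) = inn x y u * inn x y v :=
  IsALoop.inn_mul x y u v

theorem inn_inv (x y z : Q) : inn x y (inv z) = inv (inn x y z) :=
  (inv_eq_of_mul_eq_one (by rw [← inn_mul, mul_inv_self, inn_one])).symm

theorem inn_inv_right (x y : Q) : inn x y (inv y) = inv y := by
  rw [inn_inv, inn_right]

/-- Translations by `x` and `x⁻¹` commute. -/
theorem inv_mul_mul_comm (x z : Q) : inv x * (x * z) = x * (inv x * z) := by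
  rw [CommLoop.mul_comm (inv x) z, ← mul_mul_inn z x (inv x), inn_inv_right, CommLoop.mul_comm]

theorem mul_inv_mul_ldiv (x y t : Q) :
    x * (inv y * ldiv x t) = (x * y) * (ldiv (x * y) x * ldiv (x * y) t) := by
  have h₁ : inn y x (inv y) = ldiv (x * y) x := by
    rw [inn, mul_inv_self, CommLoop.mul_one]
  have h₂ : inn y x (ldiv y (ldiv x t)) = ldiv (x * y) t := by
    rw [inn, mul_ldiv, mul_ldiv]
  rw [← h₁, ← h₂, ← inn_mul, mul_mul_inn, ← inv_mul_mul_comm, mul_ldiv]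

theorem mul_inv_mul_ldiv_comm (w x : Q) :
    w * (inv x * ldiv w x) = x * (inv w * ldiv x w) := by
  rw [mul_inv_mul_ldiv w x x, mul_inv_mul_ldiv x w w, CommLoop.mul_comm x w,
    CommLoop.mul_comm (ldiv (w * x) w)]

/-- The automorphic inverse property. -/
theorem inv_mul (x y : Q) : inv (x * y) = inv x * inv y := by
  apply inn_injective (x := y) (y := x)
  have h₁ : inn y x (inv y) = ldiv (x * y) x := by
    rw [inn, mul_inv_self, CommLoop.mul_one]
  rw [inn_mul, inn_inv_right, h₁]
  apply inn_eq_of_mul_eq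
  rw [mul_inv_mul_ldiv_comm, ldiv_mul, CommLoop.mul_comm y]

theorem inv_ldiv (x y : Q) : inv (ldiv x y) = ldiv (inv x) (inv y) :=
  (eq_ldiv_of_mul_eq (by rw [← inv_mul, mul_ldiv])).symm

theorem inn_inv_inv (x y z : Q) : inn (inv x) (inv y) z = inn x y z := by
  rw [← inv_inv_self z, inn_inv x y, inn, inn, inv_ldiv]
  simp only [inv_mul]

theorem pop_mul_inv_mul (x y z : Q) : pop (x * y) (inv x * z) = x * pop y z := by
  obtain ⟨t, rfl⟩ : ∃ t, z = inv y * t := ⟨ldiv (inv y) z, (mul_ldiv _ _).symm⟩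
  have h : pop y (inv y * t) = y * t := pop_eq_of_mul_eq (inv_mul_mul_comm y t)
  apply pop_eq_of_mul_eq
  rw [h, ← mul_mul_inn y x t, ← mul_mul_inn (inv y) (inv x) t, inn_inv_inv, ← inv_mul,
    inv_mul_mul_comm]

theorem pop_inv_mul (x z : Q) : pop x (inv x * z) = x * z :=
  pop_eq_of_mul_eq (inv_mul_mul_comm x z)

theorem pop_one (x : Q) : pop x 1 = x * x :=
  pop_eq_of_mul_eq (by rw [inv_mul_mul_comm, inv_mul_self])

theorem pop_self (x : Q) : pop x x = (x * x) * x := by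
  apply pop_eq_of_mul_eq
  rw [CommLoop.mul_comm (x * x), inv_mul_mul_comm, inv_mul_mul_comm, inv_mul_self,
    CommLoop.mul_one]

theorem pop_mul_inv (x y : Q) : pop (x * y) (inv x) = x * (y * y) := by
  rw [← CommLoop.mul_one (inv x), pop_mul_inv_mul, pop_one]

theorem mul_sq (x y : Q) : (x * y) * (x * y) = x * pop y x := by
  rw [← pop_mul_inv_mul, inv_mul_self, pop_one]

theorem sqPop_inv_mul_mul (x y : Q) : sqPop x (inv x * (x * y)) = inn x x y := by
  apply sqPop_eq_of_mul_eq
  rw [mul_mul_inn, pop_inv_mul]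

theorem sqPop_mul (x u v : Q) : sqPop x (u * v) = sqPop x u * sqPop x v := by
  have surj : ∀ u : Q, ∃ u', u = inv x * (x * u') := fun u =>
    ⟨ldiv x (ldiv (inv x) u), by rw [mul_ldiv, mul_ldiv]⟩
  have hom : ∀ u, inn x (inv x) u = inv x * (x * u) := fun u =>
    inn_eq_of_mul_eq (by rw [inv_mul_self, CommLoop.one_mul])
  obtain ⟨u, rfl⟩ := surj u
  obtain ⟨v, rfl⟩ := surj v
  rw [← hom u, ← hom v, ← inn_mul, hom, hom, hom, sqPop_inv_mul_mul, sqPop_inv_mul_mul,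
    sqPop_inv_mul_mul, inn_mul]

theorem sqPop_self (x : Q) : sqPop x x = x :=
  sqPop_eq_of_mul_eq (pop_self x).symm

theorem sqPop_mul_sq (x y : Q) : sqPop x (y * (x * x)) = pop x y := by
  rw [sqPop_mul, sqPop_mul, sqPop_self, CommLoop.mul_comm, sq_mul_sqPop]

theorem inv_inn_self (x y : Q) : inv (inn x y x) = ldiv (y * x) y := by
  rw [← inn_inv, inn, mul_inv_self, CommLoop.mul_one]

theorem mul_inv_inn_self (x y : Q) : (y * x) * inv (inn x y x) = y := by
  rw [inv_inn_self, mul_ldiv]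

theorem pop_inn_self (x y : Q) : pop (inn x y x) y = (y * x) * inn x y x := by
  have h := pop_inv_mul (inn x y x) (y * x)
  rwa [CommLoop.mul_comm (inv _), mul_inv_inn_self, CommLoop.mul_comm _ (y * x)] at h

theorem inn_inn_self_mul (x y : Q) : inn (inn x y x) y (y * x) = y * inn x y x := by
  apply inn_eq_of_mul_eq
  rw [mul_sq, pop_inn_self, CommLoop.mul_comm (y * x)]

theorem inn_inn_self (x y : Q) : inn (inn x y x) y x = inn x y x := by
  apply eq_of_mul_eq_mul_left (x := y)
  rw [← inn_inn_self_mul, inn_mul, inn_right]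

theorem inn_self_mul_inv (x y : Q) : y * (inn x y x * inv (inn y x y)) = inn x y x := by
  have h : inv (inn y x y) * (y * x) = x := by
    rw [CommLoop.mul_comm, CommLoop.mul_comm y, mul_inv_inn_self]
  rw [← mul_mul_inn, ← inn_inn_self_mul, CommLoop.mul_comm, ← inn_mul, h, inn_inn_self]

theorem sqPop_inn_mul_inn (x y : Q) :
    sqPop y (inn x y x * inn y x y) = ldiv (inv y) (inn x y x) := by
  set m := inn x y x
  have h₁ : ldiv y m = m * inv (inn y x y) := eq_ldiv_of_mul_eq (inn_self_mul_inv x y)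
  have h₂ : inv (ldiv y m) = inv m * inn y x y := by
    rw [h₁, inv_mul, inv_inv_self]
  have h₃ : pop m (inv (ldiv y m)) = ldiv y m * (y * y) := by
    rw [← pop_mul_inv, CommLoop.mul_comm _ y, mul_ldiv]
  rw [← pop_inv_mul, ← h₂, h₃, sqPop_mul_sq, pop_ldiv]

theorem sqPop_sq_mul_sq (x y : Q) :
    sqPop y ((x * x) * (y * y)) = ldiv (inv y) (inn x y x) * ldiv (inv y) (inn x y x) := by
  have h₁ : inn x y x * inv (y * x) = inv y := by
    rw [← inv_inv_self (inn x y x), ← inv_mul, CommLoop.mul_comm, mul_inv_inn_self]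
  have h₂ : inn (inv (y * x)) (inn x y x) (y * x) = ldiv (inv y) (inn x y x) := by
    rw [inn, h₁, inv_mul_self, CommLoop.mul_one]
  rw [← h₂, ← inn_mul, inn, h₁, inv_mul_mul_comm, inv_mul_self, CommLoop.mul_one,
    CommLoop.mul_comm (inn x y x), mul_mul_inn, sqPop_mul_sq, pop]

theorem sq_mul_sq (x y : Q) :
    (x * x) * (y * y) = (inn x y x * inn y x y) * (inn x y x * inn y x y) := by
  apply sqPop_injective (x := y)
  rw [sqPop_sq_mul_sq, sqPop_mul, sqPop_inn_mul_inn]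

end CommLoop

open CommLoop in
/-- The product of two squares is a square: `x² y² = (x∘y)²`
with `x∘y = ((xy\x)·(yx\y))⁻¹`. -/
theorem stmt15 {Q : Type*} [CommLoop Q] [IsALoop Q] (x y : Q) :
    (x * x) * (y * y) =
      inv (ldiv (x * y) x * ldiv (y * x) y) * inv (ldiv (x * y) x * ldiv (y * x) y) ∧
    ∃ z : Q, (x * x) * (y * y) = z * z := by
  have h : inv (ldiv (x * y) x * ldiv (y * x) y) = inn x y x * inn y x y := by
    rw [← inv_inn_self, ← inv_inn_self, inv_mul, inv_inv_self, inv_inv_self,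
      CommLoop.mul_comm]
  rw [h]
  exact ⟨sq_mul_sq x y, _, sq_mul_sq x y⟩
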